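/- Let I be an EC-SNDP instance with graph G, terminal set R, edge costs and demands d_{s,t}. Construct a graph G' by replacing every Steiner vertex v of G by a clique K_v on deg_G(v) vertices whose edges all have cost 0, adding for every edge uv of G between Steiner vertices an edge of cost cost(uv) between K_u and K_v, joining every terminal to the cliques of its Steiner neighbours, and keeping edges between terminals, in such a way that every vertex of a clique K_v has exactly one neighbour outside its clique. Then for every value c, G' contains a feasible LC-SNDP solution (with the same terminal set R and demands d_{s,t}) of cost c if and only if G contains a feasible EC-SNDP solution of cost c. -/

import Mathlib

open SimpleGraph

/-- A family of `n` pairwise edge-disjoint `s`-`t` paths. -/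
def EdgeDisjPaths {V : Type*} (G : SimpleGraph V) (s t : V) (n : ℕ)
    (P : Fin n → G.Walk s t) : Prop :=
  (∀ i, (P i).IsPath) ∧ ∀ i j, i ≠ j → ∀ e, e ∈ (P i).edges → e ∉ (P j).edges

/-- The edge-connectivity `λ_G(s,t)`. -/
noncomputable def edgeConn {V : Type*} (G : SimpleGraph V) (s t : V) : ℕ :=
  sSup {n | ∃ P : Fin n → G.Walk s t, EdgeDisjPaths G s t n P}

/-- A family of `n` pairwise element-disjoint `s`-`t` paths with respect to the
terminal set `R`. -/
def ElemDisjPaths {V : Type*} (G : SimpleGraph V) (R : Set V) (s t : V) (n : ℕ)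
    (P : Fin n → G.Walk s t) : Prop :=
  (∀ i, (P i).IsPath) ∧ ∀ i j, i ≠ j →
    (∀ e, e ∈ (P i).edges → e ∉ (P j).edges) ∧
    (∀ v, v ∈ (P i).support → v ∈ (P j).support → v ∈ R)

/-- The element-connectivity `κ'_G(s,t)` w.r.t. the terminal set `R`. -/
noncomputable def elemConn {V : Type*} (G : SimpleGraph V) (R : Set V) (s t : V) : ℕ :=
  sSup {n | ∃ P : Fin n → G.Walk s t, ElemDisjPaths G R s t n P}

/-- The vertices of the clique `K_v` replacing a Steiner vertex `v`: one clique
vertex for each edge of `G` incident to `v` (represented by the dart leaving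
`v` along that edge); the number of such vertices is exactly `deg_G(v)`. -/
def CliqueVert {V : Type*} (G : SimpleGraph V) (R : Set V) : Type _ :=
  {d : G.Dart // d.fst ∉ R}

/-- The vertex set of the graph `G'` of the reduction: the terminals of `R`
together with the clique vertices replacing the Steiner vertices. -/
def VPrime {V : Type*} (G : SimpleGraph V) (R : Set V) : Type _ :=
  ↥R ⊕ CliqueVert G R

/-- The graph `G'` of the reduction from EC-SNDP to LC-SNDP: each Steiner
vertex `v` is replaced by a clique `K_v` on `deg_G(v)` vertices, two cliques
`K_u, K_v` are joined by one edge whenever `uv ∈ E(G)` (between the two clique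
vertices representing the edge `uv`, so every clique vertex has exactly one
neighbour outside its clique), every terminal is joined to the clique vertices
representing its edges to Steiner neighbours, and edges between terminals are
kept. -/
def GPrime {V : Type*} (G : SimpleGraph V) (R : Set V) : SimpleGraph (VPrime G R) :=
  SimpleGraph.fromRel fun a b =>
    match a, b with
    | Sum.inl t, Sum.inl t' => G.Adj t t'
    | Sum.inl t, Sum.inr d => d.1.snd = (t : V)
    | Sum.inr _, Sum.inl _ => False
    | Sum.inr d, Sum.inr d' =>
        d.1.fst = d'.1.fst ∨ (d'.1.fst = d.1.snd ∧ d'.1.snd = d.1.fst)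

/-- The edge costs of `G'`: clique edges cost `0`, and every other edge
inherits the cost of the edge of `G` it represents. -/
noncomputable def costPrime {V : Type*} [DecidableEq V] (G : SimpleGraph V) (R : Set V)
    (cost : Sym2 V → ℝ) : Sym2 (VPrime G R) → ℝ :=
  Sym2.lift ⟨fun a b =>
    match a, b with
    | Sum.inl t, Sum.inl t' => cost s((t : V), (t' : V))
    | Sum.inl t, Sum.inr d => cost s(d.1.fst, (t : V))
    | Sum.inr d, Sum.inl t => cost s(d.1.fst, (t : V))
    | Sum.inr d, Sum.inr d' =>
        if d.1.fst = d'.1.fst then 0 else cost s(d.1.fst, d'.1.fst),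
    by
      rintro (t | d) (t' | d')
      · show cost _ = cost _
        rw [Sym2.eq_swap]
      · rfl
      · rfl
      · show (if d.1.fst = d'.1.fst then (0:ℝ) else cost s(d.1.fst, d'.1.fst)) =
            (if d'.1.fst = d.1.fst then (0:ℝ) else cost s(d'.1.fst, d.1.fst))
        by_cases h : d.1.fst = d'.1.fst
        · rw [if_pos h, if_pos h.symm]
        · rw [if_neg h, if_neg (fun h' => h h'.symm), Sym2.eq_swap]⟩

section Connectivity

variable {V : Type*} {G : SimpleGraph V} {R : Set V} {s t : V} {n : ℕ}

theorem ElemDisjPaths.edgeDisjPaths {P : Fin n → G.Walk s t} (h : ElemDisjPaths G R s t n P) :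
    EdgeDisjPaths G s t n P :=
  ⟨h.1, fun i j hij => (h.2 i j hij).1⟩

theorem EdgeDisjPaths.le_card [Finite V] (hst : s ≠ t) {P : Fin n → G.Walk s t}
    (h : EdgeDisjPaths G s t n P) : n ≤ Nat.card (Sym2 V) := by
  have hne : ∀ i, ∃ e, e ∈ (P i).edges := fun i => by
    cases P i with
    | nil => exact absurd rfl hst
    | cons h p => exact ⟨_, List.mem_cons_self⟩
  choose f hf using hne
  have hinj : Function.Injective f := fun i j hij => by
    by_contra hne
    exact h.2 i j hne (f i) (hf i) (hij ▸ hf j)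
  simpa using Nat.card_le_card_of_injective f hinj

theorem bddAbove_edgeDisjPaths [Finite V] (hst : s ≠ t) :
    BddAbove {n | ∃ P : Fin n → G.Walk s t, EdgeDisjPaths G s t n P} :=
  ⟨Nat.card (Sym2 V), fun _ ⟨_, h⟩ => h.le_card hst⟩

theorem bddAbove_elemDisjPaths [Finite V] (hst : s ≠ t) :
    BddAbove {n | ∃ P : Fin n → G.Walk s t, ElemDisjPaths G R s t n P} :=
  ⟨Nat.card (Sym2 V), fun _ ⟨_, h⟩ => h.edgeDisjPaths.le_card hst⟩

end Connectivity

namespace VPrime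

variable {V : Type*} {G : SimpleGraph V} {R : Set V}

instance [Finite V] : Finite (VPrime G R) := by
  classical
  have := Fintype.ofFinite V
  unfold VPrime CliqueVert
  infer_instance

/-- The vertex of `G` that a vertex of `G'` stands for. -/
def base : VPrime G R → V
  | Sum.inl t => t
  | Sum.inr d => d.1.fst

open Classical in
/-- The vertex of `G'` at which the edge representing `d` leaves `d.fst`. -/
noncomputable def ofDart (R : Set V) (d : G.Dart) : VPrime G R :=
  if h : d.fst ∈ R then Sum.inl ⟨d.fst, h⟩ else Sum.inr ⟨d, h⟩

theorem ofDart_of_mem {d : G.Dart} (h : d.fst ∈ R) : ofDart R d = Sum.inl ⟨d.fst, h⟩ :=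
  dif_pos h

theorem ofDart_of_notMem {d : G.Dart} (h : d.fst ∉ R) : ofDart R d = Sum.inr ⟨d, h⟩ :=
  dif_neg h

@[simp]
theorem base_ofDart (d : G.Dart) : (ofDart R d).base = d.fst := by
  by_cases h : d.fst ∈ R
  · rw [ofDart_of_mem h]; rfl
  · rw [ofDart_of_notMem h]; rfl

theorem eq_of_inr_eq_ofDart {x : CliqueVert G R} {d : G.Dart}
    (h : (Sum.inr x : VPrime G R) = ofDart R d) : x.1 = d := by
  by_cases hd : d.fst ∈ R
  · rw [ofDart_of_mem hd] at h
    exact absurd h Sum.inr_ne_inl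
  · rw [ofDart_of_notMem hd] at h
    rw [Sum.inr.inj h]

theorem eq_of_base_eq_of_mem_range {a b : VPrime G R} (hb : b ∈ Set.range Sum.inl)
    (h : a.base = b.base) : a = b := by
  obtain ⟨t, rfl⟩ := hb
  rcases a with s | x
  · exact congrArg Sum.inl (Subtype.ext h)
  · exact absurd (show x.1.fst ∈ R from (show x.1.fst = (t : V) from h) ▸ t.2) x.2

theorem ofDart_ne_ofDart_symm (d : G.Dart) : ofDart R d ≠ ofDart R d.symm := fun h =>
  d.adj.ne (by simpa using congrArg base h)

end VPrime

open VPrime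

section Reduction

variable {V : Type*} {G : SimpleGraph V} {R : Set V}

theorem gPrime_adj_iff {a b : VPrime G R} :
    (GPrime G R).Adj a b ↔
      (a ≠ b ∧ a.base = b.base) ∨ ∃ d : G.Dart, a = ofDart R d ∧ b = ofDart R d.symm := by
  constructor
  · intro h
    obtain ⟨hne, h⟩ := h
    rcases a with t | x <;> rcases b with t' | y
    · have hadj : G.Adj t t' := h.elim id fun h => h.symm
      refine Or.inr ⟨⟨(t, t'), hadj⟩, ?_, ?_⟩
      · exact (ofDart_of_mem (R := R) (d := ⟨(t, t'), hadj⟩) t.2).symm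
      · exact (ofDart_of_mem (R := R) (d := ⟨(t', t), hadj.symm⟩) t'.2).symm
    · have hy : y.1.snd = t := h.elim id False.elim
      refine Or.inr ⟨y.1.symm, ?_, ?_⟩
      · rw [ofDart_of_mem (show y.1.snd ∈ R from hy ▸ t.2)]
        exact congrArg Sum.inl (Subtype.ext hy.symm)
      · rw [SimpleGraph.Dart.symm_symm, ofDart_of_notMem y.2]; rfl
    · have hx : x.1.snd = t' := h.elim False.elim id
      refine Or.inr ⟨x.1, ?_, ?_⟩
      · rw [ofDart_of_notMem x.2]; rfl
      · rw [ofDart_of_mem (show x.1.snd ∈ R from hx ▸ t'.2)]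
        exact congrArg Sum.inl (Subtype.ext hx.symm)
    · have key : x.1.fst = y.1.fst ∨ y.1 = x.1.symm := by
        rcases h with (h | ⟨h₁, h₂⟩) | (h | ⟨h₁, h₂⟩)
        · exact Or.inl h
        · exact Or.inr (SimpleGraph.Dart.ext _ _ (Prod.ext h₁ h₂))
        · exact Or.inl h.symm
        · exact Or.inr (SimpleGraph.Dart.ext _ _ (Prod.ext h₂.symm h₁.symm))
      rcases key with h | h
      · exact Or.inl ⟨hne, h⟩
      · refine Or.inr ⟨x.1, ?_, ?_⟩
        · rw [ofDart_of_notMem x.2]; rfl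
        · rw [← h, ofDart_of_notMem y.2]; rfl
  · rintro (⟨hne, h⟩ | ⟨d, rfl, rfl⟩)
    · refine ⟨hne, ?_⟩
      rcases b with t | y
      · exact absurd (eq_of_base_eq_of_mem_range ⟨t, rfl⟩ h) hne
      rcases a with t | x
      · exact absurd (eq_of_base_eq_of_mem_range ⟨t, rfl⟩ h.symm) hne.symm
      · exact Or.inl (Or.inl h)
    · refine ⟨ofDart_ne_ofDart_symm d, ?_⟩
      by_cases h₁ : d.fst ∈ R <;> by_cases h₂ : d.symm.fst ∈ R
      · rw [ofDart_of_mem h₁, ofDart_of_mem h₂]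
        exact Or.inl d.adj
      · rw [ofDart_of_mem h₁, ofDart_of_notMem h₂]
        exact Or.inl rfl
      · rw [ofDart_of_notMem h₁, ofDart_of_mem h₂]
        exact Or.inr rfl
      · rw [ofDart_of_notMem h₁, ofDart_of_notMem h₂]
        exact Or.inl (Or.inr ⟨rfl, rfl⟩)

/-- The subgraph of `G` obtained from a subgraph of `G'` by contracting the cliques. -/
def contractCliques (H' : SimpleGraph (VPrime G R)) : SimpleGraph V where
  Adj u v := ∃ h : G.Adj u v, H'.Adj (ofDart R ⟨(u, v), h⟩) (ofDart R ⟨(v, u), h.symm⟩)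
  symm := ⟨fun _ _ ⟨h, h'⟩ => ⟨h.symm, h'.symm⟩⟩
  loopless := ⟨fun _ ⟨h, _⟩ => G.irrefl h⟩

/-- The subgraph of `G'` consisting of all clique edges and of the edges representing `H`. -/
def expandCliques (R : Set V) (G H : SimpleGraph V) : SimpleGraph (VPrime G R) where
  Adj a b := (a ≠ b ∧ a.base = b.base) ∨
    ∃ d : G.Dart, H.Adj d.fst d.snd ∧ a = ofDart R d ∧ b = ofDart R d.symm
  symm := ⟨by
    rintro a b (⟨hne, h⟩ | ⟨d, hd, rfl, rfl⟩)
    · exact Or.inl ⟨hne.symm, h.symm⟩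
    · exact Or.inr ⟨d.symm, hd.symm, rfl, by rw [SimpleGraph.Dart.symm_symm]⟩⟩
  loopless := ⟨by
    rintro a (⟨hne, -⟩ | ⟨d, -, rfl, h⟩)
    · exact hne rfl
    · exact ofDart_ne_ofDart_symm d h⟩

theorem contractCliques_le (H' : SimpleGraph (VPrime G R)) : contractCliques H' ≤ G :=
  fun _ _ ⟨h, _⟩ => h

theorem expandCliques_le (H : SimpleGraph V) : expandCliques R G H ≤ GPrime G R := by
  rintro a b (h | ⟨d, -, h⟩)
  · exact gPrime_adj_iff.2 (Or.inl h)
  · exact gPrime_adj_iff.2 (Or.inr ⟨d, h⟩)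

theorem contractCliques_expandCliques {H : SimpleGraph V} (hH : H ≤ G) :
    contractCliques (expandCliques R G H) = H := by
  ext u v
  constructor
  · rintro ⟨h, ⟨-, h'⟩ | ⟨d, hd, h₁, h₂⟩⟩
    · simp only [base_ofDart] at h'
      exact absurd h' h.ne
    · have h₁ := congrArg base h₁
      have h₂ := congrArg base h₂
      simp only [base_ofDart] at h₁ h₂
      rw [h₁, h₂]
      exact hd
  · intro h
    exact ⟨hH h, Or.inr ⟨⟨(u, v), hH h⟩, h, rfl, rfl⟩⟩

theorem costPrime_eq [DecidableEq V] (cost : Sym2 V → ℝ) {a b : VPrime G R}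
    (h : a.base ≠ b.base) : costPrime G R cost s(a, b) = cost s(a.base, b.base) := by
  rcases a with t | x <;> rcases b with t' | y
  · rfl
  · show cost _ = cost _
    rw [Sym2.eq_swap]; rfl
  · rfl
  · exact if_neg h

theorem costPrime_eq_zero [DecidableEq V] (cost : Sym2 V → ℝ) {a b : VPrime G R}
    (hne : a ≠ b) (h : a.base = b.base) : costPrime G R cost s(a, b) = 0 := by
  rcases b with t | y
  · exact absurd (eq_of_base_eq_of_mem_range ⟨t, rfl⟩ h) hne
  rcases a with t | x
  · exact absurd (eq_of_base_eq_of_mem_range ⟨t, rfl⟩ h.symm) hne.symm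
  · exact if_pos h

theorem finsum_costPrime [DecidableEq V] (cost : Sym2 V → ℝ) {H' : SimpleGraph (VPrime G R)}
    (hH' : H' ≤ GPrime G R) :
    ∑ᶠ e ∈ H'.edgeSet, costPrime G R cost e = ∑ᶠ e ∈ (contractCliques H').edgeSet, cost e := by
  set S : Set (Sym2 (VPrime G R)) :=
    {e | ∃ d : G.Dart, e = s(ofDart R d, ofDart R d.symm) ∧
      H'.Adj (ofDart R d) (ofDart R d.symm)} with hS
  have hinj : Set.InjOn (Sym2.map base) S := by
    rintro _ ⟨d, rfl, -⟩ _ ⟨d', rfl, -⟩ h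
    simp only [Sym2.map_mk, base_ofDart] at h
    have h : d.edge = d'.edge := h
    rcases SimpleGraph.dart_edge_eq_iff d d' |>.1 h with rfl | rfl
    · rfl
    · rw [SimpleGraph.Dart.symm_symm, Sym2.eq_swap]
  have himage : Sym2.map base '' S = (contractCliques H').edgeSet := by
    ext e
    constructor
    · rintro ⟨_, ⟨d, rfl, h⟩, rfl⟩
      simp only [Sym2.map_mk, base_ofDart]
      exact ⟨d.adj, h⟩
    · induction e with
      | _ u v =>
        rintro ⟨h, h'⟩
        exact ⟨_, ⟨⟨(u, v), h⟩, rfl, h'⟩, by simp⟩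
  rw [← himage, finsum_mem_image hinj]
  have hcongr : ∑ᶠ e ∈ S, cost (Sym2.map base e) = ∑ᶠ e ∈ S, costPrime G R cost e := by
    refine finsum_mem_congr rfl ?_
    rintro _ ⟨d, rfl, -⟩
    rw [costPrime_eq cost (by simp), Sym2.map_mk]
  rw [hcongr]
  refine finsum_mem_inter_support_eq' _ _ _ fun e he => ?_
  induction e with
  | _ a b =>
    constructor
    · intro h
      have h : H'.Adj a b := h
      rcases gPrime_adj_iff.1 (hH' h) with ⟨hne, hb⟩ | ⟨d, rfl, rfl⟩
      · exact absurd (costPrime_eq_zero cost hne hb) he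
      · exact ⟨d, rfl, h⟩
    · rintro ⟨d, hd, h⟩
      rw [hd]
      exact h

theorem exists_walk_contractCliques {H' : SimpleGraph (VPrime G R)} (hH' : H' ≤ GPrime G R)
    {a b : VPrime G R} (p : H'.Walk a b) :
    ∃ q : (contractCliques H').Walk a.base b.base,
      ∀ d : G.Dart, d.edge ∈ q.edges → s(ofDart R d, ofDart R d.symm) ∈ p.edges := by
  induction p with
  | nil => exact ⟨.nil, by simp⟩
  | @cons a b c h p ih =>
    obtain ⟨q, hq⟩ := ih
    rcases gPrime_adj_iff.1 (hH' h) with ⟨-, hab⟩ | ⟨d, rfl, rfl⟩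
    · refine ⟨q.copy hab.symm rfl, fun d hd => ?_⟩
      rw [Walk.edges_copy] at hd
      exact List.mem_cons_of_mem _ (hq d hd)
    · have hadj : (contractCliques H').Adj (ofDart R d).base (ofDart R d.symm).base := by
        simp only [base_ofDart]
        exact ⟨d.adj, h⟩
      refine ⟨.cons hadj q, fun d' hd' => ?_⟩
      rw [Walk.edges_cons, List.mem_cons] at hd' ⊢
      refine hd'.imp (fun hd' => ?_) (hq d')
      simp only [base_ofDart] at hd'
      rcases SimpleGraph.dart_edge_eq_iff d' d |>.1 hd' with rfl | rfl
      · rfl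
      · rw [SimpleGraph.Dart.symm_symm, Sym2.eq_swap]

theorem exists_walk_expandCliques {H : SimpleGraph V} (hH : H ≤ G) {u v : V}
    (p : H.Walk u v) {a b : VPrime G R} (ha : a.base = u) (hb : b.base = v)
    (hbR : b ∈ Set.range Sum.inl) :
    ∃ q : (expandCliques R G H).Walk a b,
      (∀ y ∈ q.support, ∀ x : CliqueVert G R, y = Sum.inr x → y = a ∨ x.1.edge ∈ p.edges) ∧
      ∀ d : G.Dart, s(ofDart R d, ofDart R d.symm) ∈ q.edges → d.edge ∈ p.edges := by
  induction p generalizing a with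
  | nil =>
    obtain rfl := eq_of_base_eq_of_mem_range hbR (ha.trans hb.symm)
    exact ⟨.nil, fun y hy x _ => Or.inl (by simpa using hy), by simp⟩
  | @cons u w v h p ih =>
    set d : G.Dart := ⟨(u, w), hH h⟩ with hd
    obtain ⟨q, hq, hq'⟩ := ih (a := ofDart R d.symm) (by simp [hd]) hb
    have hadj : (expandCliques R G H).Adj (ofDart R d) (ofDart R d.symm) :=
      Or.inr ⟨d, h, rfl, rfl⟩
    have hsupp : ∀ y ∈ (Walk.cons hadj q).support, ∀ x : CliqueVert G R, y = Sum.inr x →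
        x.1.edge ∈ (Walk.cons h p).edges := by
      intro y hx x hyx
      rw [Walk.support_cons, List.mem_cons] at hx
      rw [Walk.edges_cons, List.mem_cons]
      rcases hx with hx | hx
      · rw [eq_of_inr_eq_ofDart (hyx.symm.trans hx)]
        exact Or.inl rfl
      · rcases hq y hx x hyx with hx | hx
        · rw [eq_of_inr_eq_ofDart (hyx.symm.trans hx), SimpleGraph.Dart.edge_symm]
          exact Or.inl rfl
        · exact Or.inr hx
    have hedge : ∀ d' : G.Dart, s(ofDart R d', ofDart R d'.symm) ∈ (Walk.cons hadj q).edges →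
        d'.edge ∈ (Walk.cons h p).edges := by
      intro d' hd'
      rw [Walk.edges_cons, List.mem_cons] at hd' ⊢
      refine hd'.imp (fun hd' => ?_) (hq' d')
      have hmap := congrArg (Sym2.map base) hd'
      simp only [Sym2.map_mk, base_ofDart] at hmap
      exact hmap
    by_cases had : a = ofDart R d
    · subst had
      exact ⟨.cons hadj q, fun y hy x hyx => Or.inr (hsupp y hy x hyx), hedge⟩
    · have hbase : a.base = (ofDart R d).base := by rw [base_ofDart]; exact ha
      have hclique : (expandCliques R G H).Adj a (ofDart R d) := Or.inl ⟨had, hbase⟩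
      refine ⟨.cons hclique (.cons hadj q), fun y hy x hyx => ?_, fun d' hd' => ?_⟩
      · rw [Walk.support_cons, List.mem_cons] at hy
        exact hy.imp id fun hy => hsupp y hy x hyx
      · rw [Walk.edges_cons, List.mem_cons] at hd'
        refine hd'.elim (fun hd' => absurd (congrArg (Sym2.map base) hd') ?_) (hedge d')
        rw [Sym2.map_mk, Sym2.map_mk, hbase, base_ofDart, base_ofDart, base_ofDart]
        intro h'
        have hdiag : (s(d'.fst, d'.symm.fst) : Sym2 V).IsDiag := h' ▸ rfl
        exact d'.adj.ne hdiag

theorem elemConn_le_edgeConn_contractCliques [Finite V] {H' : SimpleGraph (VPrime G R)}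
    (hH' : H' ≤ GPrime G R) {s t : R} (hst : s ≠ t) :
    elemConn H' (Set.range Sum.inl) (Sum.inl s) (Sum.inl t) ≤
      edgeConn (contractCliques H') (s : V) t := by
  classical
  refine csSup_le_csSup (bddAbove_edgeDisjPaths fun h => hst (Subtype.ext h))
    ⟨0, Fin.elim0, fun i => i.elim0, fun i => i.elim0⟩ ?_
  rintro n ⟨P, -, hP⟩
  choose Q hQ using fun i => exists_walk_contractCliques hH' (P i)
  refine ⟨fun i => (Q i).bypass, fun i => (Q i).bypass_isPath, fun i j hij e hi hj => ?_⟩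
  have hi := (Q i).edges_bypass_subset_edges hi
  have hj := (Q j).edges_bypass_subset_edges hj
  have he := contractCliques_le H' |> SimpleGraph.edgeSet_mono <| (Q i).edges_subset_edgeSet hi
  induction e with
  | _ u v =>
    exact (hP i j hij).1 _ (hQ i ⟨(u, v), he⟩ hi) (hQ j ⟨(u, v), he⟩ hj)

theorem edgeConn_le_elemConn_expandCliques [Finite V] {H : SimpleGraph V} (hH : H ≤ G)
    {s t : R} (hst : s ≠ t) :
    edgeConn H (s : V) t ≤
      elemConn (expandCliques R G H) (Set.range Sum.inl) (Sum.inl s) (Sum.inl t) := by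
  classical
  refine csSup_le_csSup (bddAbove_elemDisjPaths fun h => hst (Sum.inl.inj h))
    ⟨0, Fin.elim0, fun i => i.elim0, fun i => i.elim0⟩ ?_
  rintro n ⟨P, -, hP⟩
  choose Q hQ hQ' using fun i => exists_walk_expandCliques hH (P i)
    (a := Sum.inl s) (b := Sum.inl t) rfl rfl ⟨t, rfl⟩
  have hvert : ∀ i j, i ≠ j → ∀ x, x ∈ (Q i).support → x ∈ (Q j).support →
      x ∈ Set.range Sum.inl := by
    rintro i j hij (r | x) hi hj
    · exact ⟨r, rfl⟩
    · have hi := (hQ i _ hi x rfl).resolve_left Sum.inr_ne_inl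
      have hj := (hQ j _ hj x rfl).resolve_left Sum.inr_ne_inl
      exact absurd hj (hP i j hij _ hi)
  refine ⟨fun i => (Q i).bypass, fun i => (Q i).bypass_isPath, fun i j hij =>
    ⟨fun e hi hj => ?_, fun x hi hj => hvert i j hij x ((Q i).support_bypass_subset_support hi)
      ((Q j).support_bypass_subset_support hj)⟩⟩
  have hi := (Q i).edges_bypass_subset_edges hi
  have hj := (Q j).edges_bypass_subset_edges hj
  have he := (Q i).edges_subset_edgeSet hi
  induction e with
  | _ a b =>
    rcases he with ⟨hne, hab⟩ | ⟨d, -, rfl, rfl⟩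
    · exact hne (eq_of_base_eq_of_mem_range
        (hvert i j hij b ((Q i).snd_mem_support_of_mem_edges hi)
          ((Q j).snd_mem_support_of_mem_edges hj)) hab)
    · exact hP i j hij _ (hQ' i d hi) (hQ' j d hj)

end Reduction

/-- Correctness of the reduction from EC-SNDP to LC-SNDP: for every value `c`,
the graph `G'` contains a feasible LC-SNDP solution of cost `c` (w.r.t. the
terminal set `R` and the demands `d`) if and only if `G` contains a feasible
EC-SNDP solution of cost `c`. -/
theorem ec_lc_reduction_correct {V : Type*} [Fintype V] [DecidableEq V]
    (G : SimpleGraph V) (R : Set V) (cost : Sym2 V → ℝ) (hcost : ∀ e, 0 ≤ cost e)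
    (d : V → V → ℕ) (c : ℝ) :
    (∃ H' : SimpleGraph (VPrime G R), H' ≤ GPrime G R ∧
      (∀ s t : ↥R, s ≠ t →
        d ↑s ↑t ≤ elemConn H' (Set.range Sum.inl) (Sum.inl s) (Sum.inl t)) ∧
      ∑ᶠ e ∈ H'.edgeSet, costPrime G R cost e = c) ↔
    (∃ H : SimpleGraph V, H ≤ G ∧
      (∀ s ∈ R, ∀ t ∈ R, s ≠ t → d s t ≤ edgeConn H s t) ∧
      ∑ᶠ e ∈ H.edgeSet, cost e = c) := by
  constructor
  · rintro ⟨H', hH', hd, rfl⟩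
    refine ⟨contractCliques H', contractCliques_le H', fun s hs t ht hst => ?_,
      (finsum_costPrime cost hH').symm⟩
    have hst' : (⟨s, hs⟩ : R) ≠ ⟨t, ht⟩ := fun h => hst (congrArg Subtype.val h)
    exact (hd _ _ hst').trans (elemConn_le_edgeConn_contractCliques hH' hst')
  · rintro ⟨H, hH, hd, rfl⟩
    refine ⟨expandCliques R G H, expandCliques_le H, fun s t hst => ?_, ?_⟩
    · exact (hd s s.2 t t.2 fun h => hst (Subtype.ext h)).trans
        (edgeConn_le_elemConn_expandCliques hH hst)
    · rw [finsum_costPrime cost (expandCliques_le H), contractCliques_expandCliques hH]
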